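/- arXiv:2106.00796 — 5 statements merged into one kernel-verified Lean document; each statement's English description precedes it below -/
import Mathlib

section
/- Let U ⊆ ℝ² be open and let φ, φ̂ : U → ℝ be differentiable functions satisfying the Cauchy–Riemann equations on U. Suppose ρ, ρ̂ : U → ℝ are differentiable with ∂ρ/∂x₁ = φ, ∂ρ/∂x₂ = −φ̂, ∂ρ̂/∂x₁ = φ̂, and ∂ρ̂/∂x₂ = φ on U. Then the function Φ(x) = (x₁ ρ(x) + x₂ ρ̂(x))/4 is twice differentiable on U and satisfies Δ Φ = φ on U. -/
theorem hasFDerivAt_fst_mul_add_snd_mul {f g : ℝ × ℝ → ℝ} {x : ℝ × ℝ}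
    (hf : DifferentiableAt ℝ f x) (hg : DifferentiableAt ℝ g x) :
    HasFDerivAt (fun y : ℝ × ℝ => y.1 * f y + y.2 * g y)
      ((x.1 • fderiv ℝ f x + f x • ContinuousLinearMap.fst ℝ ℝ ℝ) +
        (x.2 • fderiv ℝ g x + g x • ContinuousLinearMap.snd ℝ ℝ ℝ)) x :=
  (hasFDerivAt_fst.mul hf.hasFDerivAt).add (hasFDerivAt_snd.mul hg.hasFDerivAt)

/-- Let `φ, φ̂` be differentiable on the open set `U ⊆ ℝ²` and satisfy the Cauchy–Riemann
equations there, and let `ρ, ρ̂` be differentiable on `U` with `∇ρ = (φ, −φ̂)` and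
`∇ρ̂ = (φ̂, φ)`.  Then `Φ(x) = (x₁ρ(x) + x₂ρ̂(x))/4` is twice differentiable on `U` and
satisfies `ΔΦ = φ` on `U`. -/
theorem lap_Phi_eq_phi (U : Set (ℝ × ℝ)) (hU : IsOpen U)
    (φ φh ρ ρh : ℝ × ℝ → ℝ)
    (hφ : ∀ x ∈ U, DifferentiableAt ℝ φ x)
    (hφh : ∀ x ∈ U, DifferentiableAt ℝ φh x)
    (hCR1 : ∀ x ∈ U, fderiv ℝ φ x ((1, 0) : ℝ × ℝ) = fderiv ℝ φh x ((0, 1) : ℝ × ℝ))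
    (hCR2 : ∀ x ∈ U, fderiv ℝ φ x ((0, 1) : ℝ × ℝ) = -fderiv ℝ φh x ((1, 0) : ℝ × ℝ))
    (hρ : ∀ x ∈ U, DifferentiableAt ℝ ρ x)
    (hρh : ∀ x ∈ U, DifferentiableAt ℝ ρh x)
    (hρ1 : ∀ x ∈ U, fderiv ℝ ρ x ((1, 0) : ℝ × ℝ) = φ x)
    (hρ2 : ∀ x ∈ U, fderiv ℝ ρ x ((0, 1) : ℝ × ℝ) = -φh x)
    (hρh1 : ∀ x ∈ U, fderiv ℝ ρh x ((1, 0) : ℝ × ℝ) = φh x)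
    (hρh2 : ∀ x ∈ U, fderiv ℝ ρh x ((0, 1) : ℝ × ℝ) = φ x)
    (Φ : ℝ × ℝ → ℝ) (hΦ : ∀ x : ℝ × ℝ, Φ x = (x.1 * ρ x + x.2 * ρh x) / 4) :
    ∀ x ∈ U,
      DifferentiableAt ℝ (fun y => fderiv ℝ Φ y ((1, 0) : ℝ × ℝ)) x ∧
      DifferentiableAt ℝ (fun y => fderiv ℝ Φ y ((0, 1) : ℝ × ℝ)) x ∧
      fderiv ℝ (fun y => fderiv ℝ Φ y ((1, 0) : ℝ × ℝ)) x ((1, 0) : ℝ × ℝ) +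
        fderiv ℝ (fun y => fderiv ℝ Φ y ((0, 1) : ℝ × ℝ)) x ((0, 1) : ℝ × ℝ) = φ x := by
  have hΦ' : Φ = fun y => (4 : ℝ)⁻¹ • (y.1 * ρ y + y.2 * ρh y) := by
    funext y
    rw [hΦ, smul_eq_mul]
    ring
  have hd : ∀ y ∈ U, HasFDerivAt Φ _ y := fun y hy => by
    rw [hΦ']
    exact (hasFDerivAt_fst_mul_add_snd_mul (hρ y hy) (hρh y hy)).const_smul (4 : ℝ)⁻¹
  have h1 : ∀ y ∈ U, fderiv ℝ Φ y ((1, 0) : ℝ × ℝ) =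
      (4 : ℝ)⁻¹ • (ρ y + (y.1 * φ y + y.2 * φh y)) := fun y hy => by
    rw [(hd y hy).fderiv]
    simp [hρ1 y hy, hρh1 y hy]
    ring
  have h2 : ∀ y ∈ U, fderiv ℝ Φ y ((0, 1) : ℝ × ℝ) =
      (4 : ℝ)⁻¹ • (ρh y + (y.1 * (-φh y) + y.2 * φ y)) := fun y hy => by
    rw [(hd y hy).fderiv]
    simp [hρ2 y hy, hρh2 y hy]
    ring
  intro x hx
  have hUx : U ∈ nhds x := hU.mem_nhds hx
  have d1 := (((hρ x hx).hasFDerivAt.add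
    (hasFDerivAt_fst_mul_add_snd_mul (hφ x hx) (hφh x hx))).const_smul
      (4 : ℝ)⁻¹).congr_of_eventuallyEq (Filter.eventually_of_mem hUx h1)
  have d2 := (((hρh x hx).hasFDerivAt.add
    (hasFDerivAt_fst_mul_add_snd_mul (hφh x hx).neg (hφ x hx))).const_smul
      (4 : ℝ)⁻¹).congr_of_eventuallyEq (Filter.eventually_of_mem hUx h2)
  refine ⟨d1.differentiableAt, d2.differentiableAt, ?_⟩
  rw [d1.fderiv, d2.fderiv, fderiv_neg]
  simp [hρ1 x hx, hρh2 x hx, hCR1 x hx, hCR2 x hx]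
  ring
end

section
/- Let U ⊆ ℝ² be open and let φ, φ̂ : U → ℝ be differentiable functions satisfying the Cauchy–Riemann equations on U. Suppose ρ, ρ̂ : U → ℝ are differentiable with ∂ρ/∂x₁ = φ, ∂ρ/∂x₂ = −φ̂, ∂ρ̂/∂x₁ = φ̂, and ∂ρ̂/∂x₂ = φ on U. Then the function Φ̂(x) = (x₁ ρ̂(x) − x₂ ρ(x))/4 is twice differentiable on U and satisfies Δ Φ̂ = φ̂ on U. -/
theorem hasFDerivAt_add_fst_mul_add_snd_mul {f g h : ℝ × ℝ → ℝ} {x : ℝ × ℝ}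
    (hf : DifferentiableAt ℝ f x) (hg : DifferentiableAt ℝ g x) (hh : DifferentiableAt ℝ h x)
    (c : ℝ) :
    HasFDerivAt (fun y : ℝ × ℝ => (h y + y.1 * f y + y.2 * g y) / c)
      (c⁻¹ • (fderiv ℝ h x
        + (x.1 • fderiv ℝ f x + f x • ContinuousLinearMap.fst ℝ ℝ ℝ)
        + (x.2 • fderiv ℝ g x + g x • ContinuousLinearMap.snd ℝ ℝ ℝ))) x := by
  simp only [div_eq_inv_mul]
  exact ((hh.hasFDerivAt.add (hasFDerivAt_fst.mul hf.hasFDerivAt)).add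
    (hasFDerivAt_snd.mul hg.hasFDerivAt)).const_mul c⁻¹


/-- Let `φ, φ̂` be differentiable on the open set `U ⊆ ℝ²` and satisfy the Cauchy–Riemann
equations there, and let `ρ, ρ̂` be differentiable on `U` with `∇ρ = (φ, −φ̂)` and
`∇ρ̂ = (φ̂, φ)`.  Then `Φ̂(x) = (x₁ρ̂(x) − x₂ρ(x))/4` is twice differentiable on `U` and
satisfies `ΔΦ̂ = φ̂` on `U`. -/
theorem lap_PhiHat_eq_phiHat (U : Set (ℝ × ℝ)) (hU : IsOpen U)
    (φ φh ρ ρh : ℝ × ℝ → ℝ)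
    (hφ : ∀ x ∈ U, DifferentiableAt ℝ φ x)
    (hφh : ∀ x ∈ U, DifferentiableAt ℝ φh x)
    (hCR1 : ∀ x ∈ U, fderiv ℝ φ x ((1, 0) : ℝ × ℝ) = fderiv ℝ φh x ((0, 1) : ℝ × ℝ))
    (hCR2 : ∀ x ∈ U, fderiv ℝ φ x ((0, 1) : ℝ × ℝ) = -fderiv ℝ φh x ((1, 0) : ℝ × ℝ))
    (hρ : ∀ x ∈ U, DifferentiableAt ℝ ρ x)
    (hρh : ∀ x ∈ U, DifferentiableAt ℝ ρh x)
    (hρ1 : ∀ x ∈ U, fderiv ℝ ρ x ((1, 0) : ℝ × ℝ) = φ x)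
    (hρ2 : ∀ x ∈ U, fderiv ℝ ρ x ((0, 1) : ℝ × ℝ) = -φh x)
    (hρh1 : ∀ x ∈ U, fderiv ℝ ρh x ((1, 0) : ℝ × ℝ) = φh x)
    (hρh2 : ∀ x ∈ U, fderiv ℝ ρh x ((0, 1) : ℝ × ℝ) = φ x)
    (Φh : ℝ × ℝ → ℝ) (hΦh : ∀ x : ℝ × ℝ, Φh x = (x.1 * ρh x - x.2 * ρ x) / 4) :
    ∀ x ∈ U,
      DifferentiableAt ℝ (fun y => fderiv ℝ Φh y ((1, 0) : ℝ × ℝ)) x ∧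
      DifferentiableAt ℝ (fun y => fderiv ℝ Φh y ((0, 1) : ℝ × ℝ)) x ∧
      fderiv ℝ (fun y => fderiv ℝ Φh y ((1, 0) : ℝ × ℝ)) x ((1, 0) : ℝ × ℝ) +
        fderiv ℝ (fun y => fderiv ℝ Φh y ((0, 1) : ℝ × ℝ)) x ((0, 1) : ℝ × ℝ) = φh x := by
  intro x hx
  have hΦ (y : ℝ × ℝ) (hy : y ∈ U) :=
    hasFDerivAt_add_fst_mul_add_snd_mul (hρh y hy) (hρ y hy).neg
      (differentiableAt_const (0 : ℝ)) 4
  have hΦeq : Φh = fun y : ℝ × ℝ => (0 + y.1 * ρh y + y.2 * (-ρ) y) / 4 := by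
    funext y
    rw [hΦh, Pi.neg_apply]
    ring
  have h1 : (fun y => fderiv ℝ Φh y ((1, 0) : ℝ × ℝ)) =ᶠ[nhds x]
      fun y => (ρh y + y.1 * φh y + y.2 * (-φ) y) / 4 := by
    filter_upwards [hU.mem_nhds hx] with y hy
    rw [hΦeq, (hΦ y hy).fderiv]
    simp [fderiv_neg, hρ1 y hy, hρh1 y hy]
    ring
  have h2 : (fun y => fderiv ℝ Φh y ((0, 1) : ℝ × ℝ)) =ᶠ[nhds x]
      fun y => ((-ρ) y + y.1 * φ y + y.2 * φh y) / 4 := by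
    filter_upwards [hU.mem_nhds hx] with y hy
    rw [hΦeq, (hΦ y hy).fderiv]
    simp [fderiv_neg, hρ2 y hy, hρh2 y hy]
    ring
  have d1 := (hasFDerivAt_add_fst_mul_add_snd_mul (hφh x hx) (hφ x hx).neg
    (hρh x hx) 4).congr_of_eventuallyEq h1
  have d2 := (hasFDerivAt_add_fst_mul_add_snd_mul (hφ x hx) (hφh x hx)
    (hρ x hx).neg 4).congr_of_eventuallyEq h2
  refine ⟨d1.differentiableAt, d2.differentiableAt, ?_⟩
  rw [d1.fderiv, d2.fderiv]
  simp [fderiv_neg, hρ2 x hx, hρh1 x hx, hCR1 x hx, hCR2 x hx]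
  ring
end

section
/- Let μ, ν ∈ ℝ with 0 < ν < μ, and let v₁ = r^μ sin(μθ), v₂ = r^ν sin(νθ) on the sector K of angle π/μ. Then the Dirichlet inner product in polar coordinates satisfies ∫_K ∇v₁ · ∇v₂ dx = ∫₀^{π/μ} ∫₀¹ (∂_r v₁ ∂_r v₂ + r^{−2} ∂_θ v₁ ∂_θ v₂) r dr dθ = ∫₀^{π/μ} ∫₀¹ μν r^{μ+ν−1} cos((μ−ν)θ) dr dθ = μν sin(νπ/μ) / (μ²−ν²). -/
open Real

theorem deriv_rpow_mul_sin_radial (μ θ : ℝ) {r : ℝ} (hr : 0 < r) :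
    deriv (fun s : ℝ => s ^ μ * Real.sin (μ * θ)) r = μ * r ^ (μ - 1) * Real.sin (μ * θ) :=
  ((Real.hasDerivAt_rpow_const (Or.inl hr.ne')).mul_const _).deriv

theorem deriv_rpow_mul_sin_angular (μ r θ : ℝ) :
    deriv (fun t : ℝ => r ^ μ * Real.sin (μ * t)) θ = r ^ μ * (Real.cos (μ * θ) * μ) := by
  have h := (((hasDerivAt_id θ).const_mul μ).sin.const_mul (r ^ μ)).deriv
  simpa using h

theorem polar_gradient_inner_eq (μ ν θ : ℝ) {r : ℝ} (hr : 0 < r) :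
    (deriv (fun s : ℝ => s ^ μ * Real.sin (μ * θ)) r *
        deriv (fun s : ℝ => s ^ ν * Real.sin (ν * θ)) r +
      r ^ (-2 : ℝ) * (deriv (fun t : ℝ => r ^ μ * Real.sin (μ * t)) θ *
        deriv (fun t : ℝ => r ^ ν * Real.sin (ν * t)) θ)) * r =
      μ * ν * r ^ (μ + ν - 1) * Real.cos ((μ - ν) * θ) := by
  rw [deriv_rpow_mul_sin_radial μ θ hr, deriv_rpow_mul_sin_radial ν θ hr,
    deriv_rpow_mul_sin_angular, deriv_rpow_mul_sin_angular, sub_mul, Real.cos_sub,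
    Real.rpow_sub_one hr.ne', Real.rpow_sub_one hr.ne', Real.rpow_sub_one hr.ne',
    Real.rpow_add hr, Real.rpow_neg hr.le, Real.rpow_two]
  field_simp
  ring

theorem integral_rpow_mul_cos (μ ν θ : ℝ) (h : 0 < μ + ν) :
    ∫ r in (0:ℝ)..1, μ * ν * r ^ (μ + ν - 1) * Real.cos ((μ - ν) * θ) =
      μ * ν / (μ + ν) * Real.cos ((μ - ν) * θ) := by
  rw [intervalIntegral.integral_mul_const, intervalIntegral.integral_const_mul,
    integral_rpow (Or.inl (by linarith)), sub_add_cancel, Real.one_rpow,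
    Real.zero_rpow h.ne', sub_zero, mul_one_div]

/-- For `0 < ν < μ`, with `v₁ = r^μ sin(μθ)` and `v₂ = r^ν sin(νθ)` on the sector `K` of angle
`π/μ`, the Dirichlet inner product in polar coordinates satisfies
`∫₀^{π/μ} ∫₀¹ (∂_r v₁ ∂_r v₂ + r^{−2} ∂_θ v₁ ∂_θ v₂) r dr dθ
  = ∫₀^{π/μ} ∫₀¹ μν r^{μ+ν−1} cos((μ−ν)θ) dr dθ = μν sin(νπ/μ)/(μ²−ν²)`. -/
theorem sector_H1_product (μ ν : ℝ) (hν : 0 < ν) (hνμ : ν < μ) :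
    (∫ θ in (0:ℝ)..(π / μ), ∫ r in (0:ℝ)..1,
        (deriv (fun s : ℝ => s ^ μ * Real.sin (μ * θ)) r *
            deriv (fun s : ℝ => s ^ ν * Real.sin (ν * θ)) r +
          r ^ (-2 : ℝ) * (deriv (fun t : ℝ => r ^ μ * Real.sin (μ * t)) θ *
            deriv (fun t : ℝ => r ^ ν * Real.sin (ν * t)) θ)) * r) =
      (∫ θ in (0:ℝ)..(π / μ), ∫ r in (0:ℝ)..1,
        μ * ν * r ^ (μ + ν - 1) * Real.cos ((μ - ν) * θ)) ∧
    (∫ θ in (0:ℝ)..(π / μ), ∫ r in (0:ℝ)..1,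
        μ * ν * r ^ (μ + ν - 1) * Real.cos ((μ - ν) * θ)) =
      μ * ν * Real.sin (ν * π / μ) / (μ ^ 2 - ν ^ 2) := by
  constructor
  · refine intervalIntegral.integral_congr fun θ _ => ?_
    refine intervalIntegral.integral_congr_ae (.of_forall fun r hr => ?_)
    rw [Set.uIoc_of_le zero_le_one] at hr
    exact polar_gradient_inner_eq μ ν θ hr.1
  · have hμ : 0 < μ := hν.trans hνμ
    have hd : μ - ν ≠ 0 := (sub_pos.2 hνμ).ne'
    have hs : μ + ν ≠ 0 := (add_pos hμ hν).ne'
    simp_rw [integral_rpow_mul_cos μ ν _ (add_pos hμ hν)]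
    rw [intervalIntegral.integral_const_mul, intervalIntegral.integral_comp_mul_left _ hd,
      integral_cos, mul_zero, Real.sin_zero, sub_zero,
      show (μ - ν) * (π / μ) = π - ν * π / μ by field_simp, Real.sin_pi_sub, smul_eq_mul,
      sq_sub_sq]
    field_simp
end

section
/- Let μ, ν ∈ ℝ with 1/2 < ν ≤ μ < 1, and let v₂ = r^ν sin(νθ) and v₃ = (1 − r²) r² sin(θ) sin(θ − π/μ) on the sector K of angle π/μ. Then ∫_K v₂ v₃ dx = ∫₀^{π/μ} ∫₀¹ r^ν sin(νθ) · (1−r²) r² sin(θ) sin(θ − π/μ) · r dr dθ = ( 2ν sin(π/μ) sin(νπ/μ) − 4 cos(π/μ)(1 − cos(νπ/μ)) ) / ( ν(ν+4)(ν+6)(ν²−4) ). -/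
open Real

theorem integral_rpow_mul_one_sub_sq_mul_cube {ν : ℝ} (hν : -4 < ν) :
    ∫ r in (0:ℝ)..1, r ^ ν * ((1 - r ^ 2) * r ^ 3) = 2 / ((ν + 4) * (ν + 6)) := by
  have hcongr : ∫ r in (0:ℝ)..1, r ^ ν * ((1 - r ^ 2) * r ^ 3) =
      ∫ r in (0:ℝ)..1, (r ^ (ν + 3) - r ^ (ν + 5)) := by
    refine intervalIntegral.integral_congr_ae (.of_forall fun r hr => ?_)
    rw [Set.uIoc_of_le zero_le_one] at hr
    have e3 : r ^ (ν + 3) = r ^ ν * r ^ 3 := by exact_mod_cast rpow_add_natCast hr.1.ne' ν 3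
    have e5 : r ^ (ν + 5) = r ^ ν * r ^ 5 := by exact_mod_cast rpow_add_natCast hr.1.ne' ν 5
    rw [e3, e5]
    ring
  have h4 : ν + 4 ≠ 0 := by linarith
  have h6 : ν + 6 ≠ 0 := by linarith
  rw [hcongr, intervalIntegral.integral_sub
      (intervalIntegral.intervalIntegrable_rpow' (by linarith))
      (intervalIntegral.intervalIntegrable_rpow' (by linarith)),
    integral_rpow (.inl (by linarith)), integral_rpow (.inl (by linarith)),
    show ν + 3 + 1 = ν + 4 by ring, show ν + 5 + 1 = ν + 6 by ring,
    one_rpow, one_rpow, zero_rpow h4, zero_rpow h6]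
  field_simp
  ring

theorem integral_sin_mul_sin_mul_sin_sub {ν : ℝ} (h0 : ν ≠ 0) (h2 : ν + 2 ≠ 0)
    (h2' : ν - 2 ≠ 0) (a : ℝ) :
    ∫ θ in (0:ℝ)..a, sin (ν * θ) * (sin θ * sin (θ - a)) =
      (ν * sin a * sin (ν * a) - 2 * cos a * (1 - cos (ν * a))) / (ν * (ν ^ 2 - 4)) := by
  have hderiv : ∀ θ ∈ Set.uIcc 0 a, HasDerivAt
      (fun θ => -cos a * (cos (ν * θ) / (2 * ν)) +
        (cos ((ν + 2) * θ - a) / (ν + 2) + cos ((ν - 2) * θ + a) / (ν - 2)) / 4)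
      (sin (ν * θ) * (sin θ * sin (θ - a))) θ := by
    intro θ _
    have d0 := (((hasDerivAt_id θ).const_mul ν).cos.div_const (2 * ν)).const_mul (-cos a)
    have d1 := (((hasDerivAt_id θ).const_mul (ν + 2)).sub_const a).cos.div_const (ν + 2)
    have d2 := (((hasDerivAt_id θ).const_mul (ν - 2)).add_const a).cos.div_const (ν - 2)
    refine (d0.add ((d1.add d2).div_const 4)).congr_deriv ?_
    simp only [id_eq, mul_one]
    rw [show (ν + 2) * θ - a = ν * θ + (θ + (θ - a)) by ring,
      show (ν - 2) * θ + a = ν * θ - (θ + (θ - a)) by ring,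
      sin_add (ν * θ), sin_sub (ν * θ), cos_add θ,
      show cos a = cos (θ - (θ - a)) by ring_nf, cos_sub θ]
    field_simp
    ring
  rw [intervalIntegral.integral_eq_sub_of_hasDerivAt hderiv
    (Continuous.intervalIntegrable (by fun_prop) _ _)]
  rw [show (ν + 2) * a - a = ν * a + a by ring, show (ν - 2) * a + a = ν * a - a by ring,
    cos_add, cos_sub]
  simp only [mul_zero, zero_sub, zero_add, cos_neg, cos_zero]
  rw [show ν ^ 2 - 4 = (ν + 2) * (ν - 2) by ring]
  field_simp
  ring

/-- For `1/2 < ν ≤ μ < 1`, with `v₂ = r^ν sin(νθ)` and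
`v₃ = (1 − r²)r² sin(θ) sin(θ − π/μ)` on the sector `K` of angle `π/μ`:
`∫_K v₂v₃ dx = (2ν sin(π/μ) sin(νπ/μ) − 4cos(π/μ)(1 − cos(νπ/μ)))/(ν(ν+4)(ν+6)(ν²−4))`. -/
theorem sector_L2_product_v2_v3 (μ ν : ℝ) (h1 : 1 / 2 < ν) (h2 : ν ≤ μ) (h3 : μ < 1) :
    (∫ θ in (0:ℝ)..(π / μ), ∫ r in (0:ℝ)..1,
        r ^ ν * Real.sin (ν * θ) *
          ((1 - r ^ 2) * r ^ 2 * Real.sin θ * Real.sin (θ - π / μ)) * r) =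
      (2 * ν * Real.sin (π / μ) * Real.sin (ν * π / μ) -
          4 * Real.cos (π / μ) * (1 - Real.cos (ν * π / μ))) /
        (ν * (ν + 4) * (ν + 6) * (ν ^ 2 - 4)) := by
  have hinner : ∀ θ : ℝ, (∫ r in (0:ℝ)..1, r ^ ν * sin (ν * θ) *
      ((1 - r ^ 2) * r ^ 2 * sin θ * sin (θ - π / μ)) * r) =
      2 / ((ν + 4) * (ν + 6)) * (sin (ν * θ) * (sin θ * sin (θ - π / μ))) := by
    intro θ
    rw [← integral_rpow_mul_one_sub_sq_mul_cube (by linarith),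
      ← intervalIntegral.integral_mul_const]
    congr 1
    funext r
    ring
  have hν : ν ≠ 0 := by linarith
  have hadd : ν + 2 ≠ 0 := by linarith
  have hsub : ν - 2 ≠ 0 := by linarith
  simp_rw [hinner]
  rw [intervalIntegral.integral_const_mul, integral_sin_mul_sin_mul_sin_sub hν hadd hsub,
    mul_div_assoc ν π μ, div_mul_div_comm]
  congr 1 <;> ring
end

section
/- Let μ, ν ∈ ℝ with 1/2 < ν ≤ μ < 1, and let v₂ = r^ν sin(νθ) and v₃ = (1 − r²) r² sin(θ) sin(θ − π/μ) on the sector K of angle π/μ. Then the Dirichlet inner product vanishes: ∫_K ∇v₂ · ∇v₃ dx = ∫₀^{π/μ} ∫₀¹ [ ν r^{ν−1} sin(νθ) · (2r − 4r³) sin(θ) sin(θ − π/μ) + r^{−2} · ν r^{ν} cos(νθ) · (1 − r²) r² sin(2θ − π/μ) ] r dr dθ = 0. -/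
open Real

/-- The radial integral of a difference of two power functions on `(0, 1)`. -/
lemma integral_rpow_sub_rpow (A B s : ℝ) (hs : 0 < s) :
    (∫ r in (0:ℝ)..1, (A * r ^ (s + 1) - B * r ^ (s + 3))) = A / (s + 2) - B / (s + 4) := by
  have hp : ∀ p : ℝ, 0 < p → IntervalIntegrable (fun r : ℝ => r ^ p) MeasureTheory.volume 0 1 :=
    fun p hp => intervalIntegral.intervalIntegrable_rpow' (by linarith)
  rw [intervalIntegral.integral_sub ((hp _ (by linarith)).const_mul A)
      ((hp _ (by linarith)).const_mul B),
    intervalIntegral.integral_const_mul, intervalIntegral.integral_const_mul,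
    integral_rpow (Or.inl (by linarith)), integral_rpow (Or.inl (by linarith)),
    Real.zero_rpow (by linarith), Real.zero_rpow (by linarith), Real.one_rpow, Real.one_rpow,
    show s + 1 + 1 = s + 2 by ring, show s + 3 + 1 = s + 4 by ring]
  ring

/-- For `1/2 < ν ≤ μ < 1`, with `v₂ = r^ν sin(νθ)` and
`v₃ = (1 − r²)r² sin(θ) sin(θ − π/μ)` on the sector `K` of angle `π/μ`, the Dirichlet inner
product vanishes:
`∫₀^{π/μ} ∫₀¹ [ν r^{ν−1} sin(νθ)(2r − 4r³) sin(θ) sin(θ − π/μ)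
  + r^{−2} ν r^ν cos(νθ)(1 − r²) r² sin(2θ − π/μ)] r dr dθ = 0`. -/
theorem sector_H1_product_v2_v3 (μ ν : ℝ) (h1 : 1 / 2 < ν) (h2 : ν ≤ μ) (h3 : μ < 1) :
    (∫ θ in (0:ℝ)..(π / μ), ∫ r in (0:ℝ)..1,
        (ν * r ^ (ν - 1) * Real.sin (ν * θ) *
            ((2 * r - 4 * r ^ 3) * Real.sin θ * Real.sin (θ - π / μ)) +
          r ^ (-2 : ℝ) * (ν * r ^ ν * Real.cos (ν * θ)) *
            ((1 - r ^ 2) * r ^ 2 * Real.sin (2 * θ - π / μ))) * r) = 0 := by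
  have hν : 0 < ν := by linarith
  have inner : ∀ θ : ℝ, (∫ r in (0:ℝ)..1,
        (ν * r ^ (ν - 1) * Real.sin (ν * θ) *
            ((2 * r - 4 * r ^ 3) * Real.sin θ * Real.sin (θ - π / μ)) +
          r ^ (-2 : ℝ) * (ν * r ^ ν * Real.cos (ν * θ)) *
            ((1 - r ^ 2) * r ^ 2 * Real.sin (2 * θ - π / μ))) * r) =
      2 * ν / ((ν + 2) * (ν + 4)) *
        (-(ν * Real.sin (ν * θ)) * (Real.sin θ * Real.sin (θ - π / μ)) +
          Real.cos (ν * θ) * Real.sin (2 * θ - π / μ)) := by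
    intro θ
    rw [show 2 * ν / ((ν + 2) * (ν + 4)) *
        (-(ν * Real.sin (ν * θ)) * (Real.sin θ * Real.sin (θ - π / μ)) +
          Real.cos (ν * θ) * Real.sin (2 * θ - π / μ)) =
        ν * (2 * (Real.sin (ν * θ) * (Real.sin θ * Real.sin (θ - π / μ))) +
            Real.cos (ν * θ) * Real.sin (2 * θ - π / μ)) / (ν + 2) -
          ν * (4 * (Real.sin (ν * θ) * (Real.sin θ * Real.sin (θ - π / μ))) +
            Real.cos (ν * θ) * Real.sin (2 * θ - π / μ)) / (ν + 4) by
        field_simp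
        ring,
      ← integral_rpow_sub_rpow _ _ _ hν]
    refine intervalIntegral.integral_congr fun r hr => ?_
    rw [Set.uIcc_of_le zero_le_one] at hr
    rcases hr.1.eq_or_lt with h | hr0
    · subst h
      simp [Real.zero_rpow (show ν + 1 ≠ 0 by linarith),
        Real.zero_rpow (show ν + 3 ≠ 0 by linarith)]
    · have e1 : r ^ (ν - 1) = r ^ ν / r := by rw [Real.rpow_sub hr0, Real.rpow_one]
      have e2 : r ^ (-2 : ℝ) = (r ^ 2)⁻¹ := by
        rw [Real.rpow_neg hr0.le]
        norm_cast
      have e3 : r ^ (ν + 1) = r ^ ν * r := by rw [Real.rpow_add hr0, Real.rpow_one]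
      have e4 : r ^ (ν + 3) = r ^ ν * r ^ 3 := by
        rw [Real.rpow_add hr0]
        norm_cast
      simp only [e1, e2, e3, e4]
      field_simp
      ring
  simp_rw [inner]
  have hderiv : ∀ θ : ℝ, HasDerivAt
      (fun θ => Real.cos (ν * θ) * (Real.sin θ * Real.sin (θ - π / μ)))
      (-(ν * Real.sin (ν * θ)) * (Real.sin θ * Real.sin (θ - π / μ)) +
          Real.cos (ν * θ) * Real.sin (2 * θ - π / μ)) θ := by
    intro θ
    have hc := ((hasDerivAt_id θ).const_mul ν).cos
    have hs := (Real.hasDerivAt_sin θ).mul ((hasDerivAt_id θ).sub_const (π / μ)).sin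
    refine (hc.mul hs).congr_deriv ?_
    rw [show 2 * θ - π / μ = θ + (θ - π / μ) by ring, Real.sin_add θ]
    simp
    ring
  rw [intervalIntegral.integral_const_mul,
    intervalIntegral.integral_eq_sub_of_hasDerivAt (fun θ _ => hderiv θ)
      (Continuous.intervalIntegrable (by fun_prop) _ _)]
  simp
end
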